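/- For every ε with 0 < ε < 1 there exist a constant c > 0 and an integer n₀ such that for every n ≥ n₀ there exists a transitive DFA with n states and exactly 2 symbols, together with a subset S of its state set, such that S is synchronized by some word and the shortest word synchronizing S has length at least c · (3 − ε)^{n/6}. -/

import Mathlib

/-- Action of a DFA transition function on a subset of states along a word. -/
def dfaRun {n m : ℕ} (δ : Fin n → Fin m → Fin n) :
    Finset (Fin n) → List (Fin m) → Finset (Fin n)
  | S, [] => S
  | S, a :: w => dfaRun δ (S.image fun q => δ q a) w

/-- A word `w` synchronizes the subset `S` in the DFA `δ`. -/
def dfaSync {n m : ℕ} (δ : Fin n → Fin m → Fin n) (S : Finset (Fin n))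
    (w : List (Fin m)) : Prop :=
  (dfaRun δ S w).card = 1

/-- A DFA is transitive if every state can be sent to every other state by some word. -/
def dfaTransitive {n m : ℕ} (δ : Fin n → Fin m → Fin n) : Prop :=
  ∀ q q' : Fin n, ∃ w, dfaRun δ {q} w = {q'}

/-- A transitive binary DFA on `Q` with a letter acting non-injectively, and a nonempty set of
states that can be synchronized, but only by words of length at least `B - 1`. -/
def HasSlowSubset (Q : Type) (B : ℕ) : Prop :=
  ∃ (δ : Q → Fin 2 → Q) (S : Set Q),
    (∀ q q', ∃ w : List (Fin 2), w.foldl δ q = q') ∧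
    (∃ q₁ q₂, q₁ ≠ q₂ ∧ δ q₁ 0 = δ q₂ 0) ∧
    S.Nonempty ∧
    (∃ (w : List (Fin 2)) (q : Q), ∀ s ∈ S, w.foldl δ s = q) ∧
    ∀ (w : List (Fin 2)) (q : Q), (∀ s ∈ S, w.foldl δ s = q) → B ≤ w.length + 1

/-- Duplicating a state that has two incoming edges with the same label adds one state. -/
theorem HasSlowSubset.option {Q : Type} {B : ℕ} (h : HasSlowSubset Q B) :
    HasSlowSubset (Option Q) B := by
  classical
  obtain ⟨δ, S, htrans, ⟨q₁, q₂, hne, heq⟩, hS, ⟨w₀, r₀, hw₀⟩, hlow⟩ := h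
  let π : Option Q → Q := fun o => o.getD (δ q₁ 0)
  let δ' : Option Q → Fin 2 → Option Q := fun o x =>
    if π o = q₁ ∧ x = 0 then none else some (δ (π o) x)
  have hstep : ∀ o x, π (δ' o x) = δ (π o) x := by
    intro o x
    by_cases hc : π o = q₁ ∧ x = 0
    · simp only [δ', if_pos hc]
      obtain ⟨h1, rfl⟩ := hc
      rw [h1]
      rfl
    · simp only [δ', if_neg hc]
      rfl
  have hrun : ∀ (w : List (Fin 2)) o, π (w.foldl δ' o) = w.foldl δ (π o) := by
    intro w
    induction w with
    | nil => intro o; rfl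
    | cons x w ih => intro o; rw [List.foldl_cons, List.foldl_cons, ih, hstep]
  have hlift : ∀ o q, ∃ w : List (Fin 2), π (w.foldl δ' o) = q := by
    intro o q
    obtain ⟨w, hw⟩ := htrans (π o) q
    exact ⟨w, by rw [hrun, hw]⟩
  refine ⟨δ', some '' S, ?_, ⟨some (δ q₁ 0), none, by simp, rfl⟩, hS.image _, ?_, ?_⟩
  · intro o o'
    cases o' with
    | none =>
      obtain ⟨w, hw⟩ := hlift o q₁
      exact ⟨w ++ [0], by simp [δ', hw]⟩
    | some q =>
      by_cases hq : q = δ q₁ 0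
      · obtain ⟨w, hw⟩ := hlift o q₂
        exact ⟨w ++ [0], by simp [δ', hw, hne.symm, hq, heq]⟩
      · obtain ⟨w, hw⟩ := hlift o q
        refine ⟨w, ?_⟩
        generalize w.foldl δ' o = r at hw
        cases r with
        | none => exact absurd hw.symm hq
        | some r => exact congrArg some hw
  · refine ⟨w₀ ++ [0], δ' (some r₀) 0, ?_⟩
    rintro _ ⟨s, hs, rfl⟩
    have h1 : π (w₀.foldl δ' (some s)) = r₀ := by rw [hrun]; exact hw₀ s hs
    rw [List.foldl_append, List.foldl_cons, List.foldl_nil]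
    simp only [δ', h1]
    rfl
  · intro w q hw
    refine hlow w (π q) fun s hs => ?_
    rw [← hw (some s) ⟨s, hs, rfl⟩, hrun]
    rfl

theorem HasSlowSubset.congr {Q R : Type} {B : ℕ} (e : Q ≃ R) (h : HasSlowSubset Q B) :
    HasSlowSubset R B := by
  obtain ⟨δ, S, htrans, ⟨q₁, q₂, hne, heq⟩, hS, ⟨w₀, r₀, hw₀⟩, hlow⟩ := h
  let δ' : R → Fin 2 → R := fun r x => e (δ (e.symm r) x)
  have hrun : ∀ (w : List (Fin 2)) q, w.foldl δ' (e q) = e (w.foldl δ q) := by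
    intro w
    induction w with
    | nil => intro q; rfl
    | cons x w ih =>
      intro q
      rw [List.foldl_cons, List.foldl_cons, ← ih]
      simp [δ']
  refine ⟨δ', e '' S, ?_, ⟨e q₁, e q₂, by simpa using hne, by simp [δ', heq]⟩, hS.image _, ?_, ?_⟩
  · intro r r'
    obtain ⟨w, hw⟩ := htrans (e.symm r) (e.symm r')
    refine ⟨w, ?_⟩
    have h1 := hrun w (e.symm r)
    rwa [hw, e.apply_symm_apply, e.apply_symm_apply] at h1
  · refine ⟨w₀, e r₀, ?_⟩
    rintro _ ⟨s, hs, rfl⟩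
    rw [hrun, hw₀ s hs]
  · intro w r hw
    refine hlow w (e.symm r) fun s hs => ?_
    rw [← hw (e s) ⟨s, hs, rfl⟩, hrun, e.symm_apply_apply]

theorem HasSlowSubset.fin_add {n B : ℕ} (h : HasSlowSubset (Fin n) B) (k : ℕ) :
    HasSlowSubset (Fin (n + k)) B := by
  induction k with
  | zero => exact h
  | succ k ih => exact ih.option.congr (finSuccEquiv (n + k)).symm

theorem dfaRun_eq_image {n m : ℕ} (δ : Fin n → Fin m → Fin n) (S : Finset (Fin n))
    (w : List (Fin m)) : dfaRun δ S w = S.image fun q => w.foldl δ q := by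
  induction w generalizing S with
  | nil => simp [dfaRun]
  | cons x w ih =>
    rw [dfaRun, ih, Finset.image_image]
    rfl

theorem HasSlowSubset.exists_dfa {n B : ℕ} (h : HasSlowSubset (Fin n) B) :
    ∃ (δ : Fin n → Fin 2 → Fin n) (S : Finset (Fin n)),
      dfaTransitive δ ∧ (∃ w, dfaSync δ S w) ∧ ∀ w, dfaSync δ S w → B ≤ w.length + 1 := by
  classical
  obtain ⟨δ, S, htrans, -, ⟨s₀, hs₀⟩, ⟨w₀, r₀, hw₀⟩, hlow⟩ := h
  refine ⟨δ, S.toFinset, ?_, ⟨w₀, ?_⟩, ?_⟩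
  · intro q q'
    obtain ⟨w, hw⟩ := htrans q q'
    exact ⟨w, by rw [dfaRun_eq_image, Finset.image_singleton, hw]⟩
  · rw [dfaSync, dfaRun_eq_image, Finset.card_eq_one]
    refine ⟨r₀, Finset.eq_singleton_iff_unique_mem.2 ⟨?_, ?_⟩⟩
    · exact Finset.mem_image.2 ⟨s₀, by simpa using hs₀, hw₀ s₀ hs₀⟩
    · intro r hr
      obtain ⟨s, hs, rfl⟩ := Finset.mem_image.1 hr
      exact hw₀ s (by simpa using hs)
  · intro w hw
    rw [dfaSync, dfaRun_eq_image, Finset.card_eq_one] at hw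
    obtain ⟨r, hr⟩ := hw
    refine hlow w r fun s hs => ?_
    rw [← Finset.mem_singleton, ← hr]
    exact Finset.mem_image_of_mem _ (by simpa using hs)

namespace TernaryCounter

/-- The operations of the counter: the word `1 ^ j 0` performs the `j`-th of them on the head cell
and then rotates the tape. The phase `reset` only serves to make the automaton transitive. -/
inductive Phase
  | copy | carry | incr | erase | mark | reset
  deriving DecidableEq

instance : Fintype Phase where
  elems := {.copy, .carry, .incr, .erase, .mark, .reset}
  complete := by intro j; cases j <;> simp

/-- The phase following a given one under the letter `1`. -/
def Phase.next : Phase → Phase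
  | copy => carry
  | carry => incr
  | incr => erase
  | erase => mark
  | mark => reset
  | reset => reset

/-- Tokens aware of the phase: the digit in the head cell, the control token in one of three
modes, and an immobile anchor. -/
inductive Token
  | digit (p : Fin 3) | carrying | copying | erasing | anchor
  deriving DecidableEq, Fintype

/-- States up to sign: a digit in a cell of the tape away from the head, or a phase-aware token. -/
inductive Cell (m : ℕ)
  | ring (i : Fin (m + 1)) (p : Fin 3)
  | core (j : Phase) (k : Token)
  deriving DecidableEq, Fintype

open Phase Token Cell

/-- The effect of an operation: a digit to be written at the end of the tape, a phase-aware token,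
or `none` if the operation is forbidden. -/
def act : Phase → Token → Option (Fin 3 ⊕ Token)
  | _, anchor => some (.inr anchor)
  | copy, digit p => some (.inl p)
  | copy, copying => some (.inr copying)
  | carry, digit 2 => some (.inl 0)
  | carry, carrying => some (.inr carrying)
  | incr, digit 0 => some (.inl 1)
  | incr, digit 1 => some (.inl 2)
  | incr, carrying => some (.inr copying)
  | erase, digit 2 => some (.inr anchor)
  | erase, carrying => some (.inr erasing)
  | erase, erasing => some (.inr erasing)
  | mark, copying => some (.inr carrying)
  | mark, erasing => some (.inr anchor)
  | _, _ => none

/-- Where the result of an operation is put; the Boolean tells whether the sign is changed. A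
forbidden operation sends the token onto the anchor with the opposite sign. -/
def place {m : ℕ} : Option (Fin 3 ⊕ Token) → Cell m × Bool
  | some (.inl p) => (ring (Fin.last m) p, false)
  | some (.inr k) => (core copy k, false)
  | none => (core copy anchor, true)

/-- The action of the letter `0` up to sign, with the sign change. -/
def rotate {m : ℕ} : Cell m → Cell m × Bool
  | ring ⟨0, _⟩ p => (core copy (digit p), false)
  | ring ⟨i + 1, h⟩ p => (ring ⟨i, Nat.lt_of_succ_lt h⟩ p, false)
  | core reset anchor => (core copy (digit 0), false)
  | core reset (digit _) => (core copy anchor, false)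
  | core reset _ => (core copy (digit 0), true)
  | core j k => place (act j k)

/-- The action of the letter `1` up to sign, with the sign change. -/
def advance {m : ℕ} : Cell m → Cell m × Bool
  | ring i p => (ring i p, false)
  | core reset anchor => (core copy carrying, false)
  | core reset (digit _) => (core copy anchor, false)
  | core reset _ => (core copy carrying, true)
  | core j k => (core j.next k, false)

/-- The automaton on signed states. -/
def step {m : ℕ} (q : Cell m × Bool) (x : Fin 2) : Cell m × Bool :=
  let r := if x = 0 then rotate q.1 else advance q.1
  (r.1, xor q.2 r.2)

theorem foldl_step_not {m : ℕ} (w : List (Fin 2)) (q : Cell m) (s : Bool) :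
    w.foldl step (q, !s) = ((w.foldl step (q, s)).1, !(w.foldl step (q, s)).2) := by
  induction w generalizing q s with
  | nil => rfl
  | cons x w ih =>
    rw [List.foldl_cons, List.foldl_cons]
    simp only [step]
    rw [← ih, Bool.not_xor]

theorem foldl_step_ne {m : ℕ} (w : List (Fin 2)) (q : Cell m) :
    w.foldl step (q, true) ≠ w.foldl step (q, false) := by
  rw [show true = !false from rfl, foldl_step_not]
  intro h
  simpa using congrArg Prod.snd h

theorem card_signed (m : ℕ) : Fintype.card (Cell m × Bool) = 6 * m + 90 := by
  let e : Cell m ≃ (Fin (m + 1) × Fin 3) ⊕ (Phase × Token) :=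
    { toFun := fun q => match q with
        | ring i p => .inl (i, p)
        | core j k => .inr (j, k)
      invFun := fun q => match q with
        | .inl (i, p) => ring i p
        | .inr (j, k) => core j k
      left_inv := by rintro (_ | _) <;> rfl
      right_inv := by rintro (_ | _) <;> rfl }
  have h1 : Fintype.card Phase = 6 := rfl
  have h2 : Fintype.card Token = 7 := rfl
  rw [Fintype.card_prod, Fintype.card_congr e]
  simp only [Fintype.card_sum, Fintype.card_prod, Fintype.card_fin, Fintype.card_bool, h1, h2]
  ring

/-- Reachability in the signed automaton. -/
def Reaches {m : ℕ} (q q' : Cell m × Bool) : Prop :=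
  ∃ w : List (Fin 2), w.foldl step q = q'

theorem Reaches.trans {m : ℕ} {q q' q'' : Cell m × Bool} (h : Reaches q q')
    (h' : Reaches q' q'') : Reaches q q'' := by
  obtain ⟨w, rfl⟩ := h
  obtain ⟨w', rfl⟩ := h'
  exact ⟨w ++ w', List.foldl_append⟩

theorem reaches_ring_of_le {m : ℕ} (i : ℕ) (hi : i < m + 1) (d : ℕ) (hd : i + d < m + 1)
    (p : Fin 3) (s : Bool) :
    Reaches (m := m) (ring ⟨i + d, hd⟩ p, s) (ring ⟨i, hi⟩ p, s) := by
  induction d with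
  | zero => exact ⟨[], rfl⟩
  | succ d ih =>
    have h := ih (by omega)
    exact Reaches.trans ⟨[0], by cases s <;> rfl⟩ h

theorem reaches_last_ring {m : ℕ} (i : Fin (m + 1)) (p : Fin 3) (s : Bool) :
    Reaches (m := m) (ring (Fin.last m) p, s) (ring i p, s) := by
  have hi := i.2
  have h := reaches_ring_of_le (m := m) i.1 i.2 (m - i.1) (by omega) p s
  have h1 : (⟨i.1 + (m - i.1), by omega⟩ : Fin (m + 1)) = Fin.last m := by
    ext
    simp only [Fin.val_last]
    omega
  rwa [h1] at h

theorem reaches_ring_head {m : ℕ} (i : Fin (m + 1)) (p : Fin 3) (s : Bool) :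
    Reaches (m := m) (ring i p, s) (core copy (digit p), s) := by
  have hi := i.2
  have h := reaches_ring_of_le (m := m) 0 (by omega) i.1 (by omega) p s
  simp only [zero_add] at h
  exact h.trans ⟨[0], by cases s <;> rfl⟩

theorem reaches_phase {m : ℕ} (j : Phase) (k : Token) (s : Bool) :
    Reaches (m := m) (core copy k, s) (core j k, s) := by
  cases j
  · exact ⟨[], rfl⟩
  · exact ⟨[1], by cases s <;> rfl⟩
  · exact ⟨[1, 1], by cases s <;> rfl⟩
  · exact ⟨[1, 1, 1], by cases s <;> rfl⟩
  · exact ⟨[1, 1, 1, 1], by cases s <;> rfl⟩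
  · exact ⟨[1, 1, 1, 1, 1], by cases s <;> rfl⟩

theorem reaches_digit {m : ℕ} (p : Fin 3) (s : Bool) :
    Reaches (m := m) (core copy anchor, s) (core copy (digit p), s) := by
  have h0 : Reaches (m := m) (core copy anchor, s) (core copy (digit 0), s) :=
    (reaches_phase reset _ _).trans ⟨[0], by cases s <;> rfl⟩
  have h1 : Reaches (m := m) (core copy (digit 0), s) (core copy (digit 1), s) :=
    (reaches_phase incr _ _).trans
      (Reaches.trans ⟨[0], by cases s <;> rfl⟩ (reaches_ring_head (Fin.last m) _ _))
  have h2 : Reaches (m := m) (core copy (digit 1), s) (core copy (digit 2), s) :=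
    (reaches_phase incr _ _).trans
      (Reaches.trans ⟨[0], by cases s <;> rfl⟩ (reaches_ring_head (Fin.last m) _ _))
  fin_cases p
  · exact h0
  · exact h0.trans h1
  · exact (h0.trans h1).trans h2

theorem reaches_of_anchor {m : ℕ} (q : Cell m) (s : Bool) :
    Reaches (m := m) (core copy anchor, s) (q, s) := by
  have hc : Reaches (m := m) (core copy anchor, s) (core copy carrying, s) :=
    (reaches_phase reset _ _).trans ⟨[1], by cases s <;> rfl⟩
  cases q with
  | ring i p =>
    exact (reaches_digit p s).trans
      (Reaches.trans ⟨[0], by cases s <;> rfl⟩ (reaches_last_ring i p s))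
  | core j k =>
    refine Reaches.trans ?_ (reaches_phase j k s)
    cases k with
    | digit p => exact reaches_digit p s
    | carrying => exact hc
    | copying => exact (hc.trans (reaches_phase incr _ _)).trans ⟨[0], by cases s <;> rfl⟩
    | erasing => exact (hc.trans (reaches_phase erase _ _)).trans ⟨[0], by cases s <;> rfl⟩
    | anchor => exact ⟨[], rfl⟩

theorem reaches_anchor {m : ℕ} (q : Cell m) (s : Bool) :
    ∃ s', Reaches (m := m) (q, s) (core copy anchor, s') := by
  have hcore : ∀ j k, ∃ s', Reaches (m := m) (core j k, s) (core copy anchor, s') := by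
    intro j k
    have h : Reaches (m := m) (core j k, s) (core reset k, s) := by
      cases j
      · exact ⟨[1, 1, 1, 1, 1], by cases s <;> rfl⟩
      · exact ⟨[1, 1, 1, 1], by cases s <;> rfl⟩
      · exact ⟨[1, 1, 1], by cases s <;> rfl⟩
      · exact ⟨[1, 1], by cases s <;> rfl⟩
      · exact ⟨[1], by cases s <;> rfl⟩
      · exact ⟨[], rfl⟩
    cases k <;> exact ⟨_, h.trans ⟨[1, 0], rfl⟩⟩
  cases q with
  | ring i p =>
    obtain ⟨s', h⟩ := hcore copy (digit p)
    exact ⟨s', (reaches_ring_head i p s).trans h⟩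
  | core j k => exact hcore j k

theorem reaches_anchor_not {m : ℕ} (s : Bool) :
    Reaches (m := m) (core copy anchor, s) (core copy anchor, !s) :=
  ((reaches_digit 0 s).trans (reaches_phase carry _ _)).trans ⟨[0], by cases s <;> rfl⟩

theorem reaches_all {m : ℕ} (q q' : Cell m × Bool) : Reaches q q' := by
  obtain ⟨q, s⟩ := q
  obtain ⟨q', s'⟩ := q'
  obtain ⟨t, ht⟩ := reaches_anchor q s
  refine ht.trans ?_
  by_cases h : t = s'
  · subst h
    exact reaches_of_anchor q' t
  · obtain rfl : s' = !t := by cases t <;> cases s' <;> simp_all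
    exact (reaches_anchor_not t).trans (reaches_of_anchor q' _)

/-- The set of states encoding the tape `L` (head cell first) in phase `j` with control `c`. -/
def tokens {m : ℕ} (j : Phase) (c : Token) (L : List (Option (Fin 3))) : Set (Cell m × Bool) :=
  {q | q.2 = false ∧ match q.1 with
    | ring i p => L[i.1 + 1]? = some (some p)
    | core j' k => j' = j ∧ (k = anchor ∨ k = c ∨ ∃ p, k = digit p ∧ L[0]? = some (some p))}

/-- The operation `j` turns the first content (a digit or nothing) of the head cell into the second. -/
def Rewrites (j : Phase) : Option (Fin 3) → Option (Fin 3) → Prop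
  | none, h' => h' = none
  | some p, some p' => act j (digit p) = some (.inl p')
  | some p, none => act j (digit p) = some (.inr anchor)

theorem act_anchor (j : Phase) : act j anchor = some (.inr anchor) := by
  cases j <;> rfl

theorem rotate_core {m : ℕ} {j : Phase} (hj : j ≠ reset) (k : Token) :
    rotate (core j k : Cell m) = place (act j k) := by
  cases j <;> first | rfl | exact absurd rfl hj

theorem step_core_zero {m : ℕ} {j : Phase} (hj : j ≠ reset) {k : Token} {r : Fin 3 ⊕ Token}
    (h : act j k = some r) :
    step (m := m) (core j k, false) 0 = ((place (some r) : Cell m × Bool).1, false) := by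
  simp only [step, if_true, rotate_core hj, h]
  cases r <;> rfl

theorem image_tokens_zero {m : ℕ} {j : Phase} (hj : j ≠ reset) {c c' : Token}
    (hc : act j c = some (.inr c')) {h h' : Option (Fin 3)} (hh : Rewrites j h h')
    {L : List (Option (Fin 3))} (hL : L.length = m + 1) :
    (step · 0) '' tokens (m := m) j c (h :: L) = tokens copy c' (L ++ [h']) := by
  apply Set.Subset.antisymm
  · rintro _ ⟨⟨q, s⟩, ⟨rfl, hq⟩, rfl⟩
    cases q with
    | ring i p =>
      obtain ⟨i, hi⟩ := i
      simp only [List.getElem?_cons_succ] at hq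
      cases i with
      | zero =>
        refine ⟨rfl, rfl, Or.inr (Or.inr ⟨p, rfl, ?_⟩)⟩
        rw [List.getElem?_append_left (by omega), hq]
      | succ i =>
        refine ⟨rfl, ?_⟩
        change (L ++ [h'])[i + 1]? = some (some p)
        rw [List.getElem?_append_left (by omega), hq]
    | core j' k =>
      obtain ⟨rfl, rfl | rfl | ⟨p, rfl, hp⟩⟩ := hq
      · simp only [step_core_zero hj (act_anchor _)]
        exact ⟨rfl, rfl, Or.inl rfl⟩
      · simp only [step_core_zero hj hc]
        exact ⟨rfl, rfl, Or.inr (Or.inl rfl)⟩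
      · obtain rfl : h = some p := by simpa using hp
        cases h' with
        | none =>
          simp only [step_core_zero hj hh]
          exact ⟨rfl, rfl, Or.inl rfl⟩
        | some p' =>
          simp only [step_core_zero hj hh]
          refine ⟨rfl, ?_⟩
          change (L ++ [some p'])[m + 1]? = some (some p')
          rw [← hL]
          simp
  · rintro ⟨q, s⟩ ⟨hs, hq⟩
    obtain rfl : s = false := hs
    cases q with
    | ring i p =>
      obtain ⟨i, hi⟩ := i
      change (L ++ [h'])[i + 1]? = some (some p) at hq
      by_cases him : i = m
      · subst him
        rw [← hL] at hq
        obtain rfl : h' = some p := by simpa using hq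
        cases h with
        | none => exact absurd hh (by simp [Rewrites])
        | some p₀ =>
          exact ⟨(core j (digit p₀), false), ⟨rfl, rfl, Or.inr (Or.inr ⟨p₀, rfl, rfl⟩)⟩,
            step_core_zero hj hh⟩
      · rw [List.getElem?_append_left (by omega)] at hq
        exact ⟨(ring ⟨i + 1, by omega⟩ p, false), ⟨rfl, by simpa using hq⟩, rfl⟩
    | core j' k =>
      obtain ⟨rfl, rfl | rfl | ⟨p, rfl, hp⟩⟩ := hq
      · exact ⟨(core j anchor, false), ⟨rfl, rfl, Or.inl rfl⟩, step_core_zero hj (act_anchor j)⟩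
      · exact ⟨(core j c, false), ⟨rfl, rfl, Or.inr (Or.inl rfl)⟩, step_core_zero hj hc⟩
      · rw [List.getElem?_append_left (by omega)] at hp
        exact ⟨(ring ⟨0, by omega⟩ p, false), ⟨rfl, by simpa using hp⟩, rfl⟩

theorem image_tokens_one {m : ℕ} {j : Phase} (hj : j ≠ reset) (c : Token)
    (L : List (Option (Fin 3))) :
    (step · 1) '' tokens (m := m) j c L = tokens j.next c L := by
  have hcore : ∀ k, step (m := m) (core j k, false) 1 = (core j.next k, false) := by
    intro k
    cases j <;> first | rfl | exact absurd rfl hj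
  apply Set.Subset.antisymm
  · rintro _ ⟨⟨q, s⟩, ⟨rfl, hq⟩, rfl⟩
    cases q with
    | ring i p => exact ⟨rfl, hq⟩
    | core j' k =>
      obtain ⟨rfl, hk⟩ := hq
      simp only [hcore]
      exact ⟨rfl, rfl, hk⟩
  · rintro ⟨q, s⟩ ⟨hs, hq⟩
    obtain rfl : s = false := hs
    cases q with
    | ring i p => exact ⟨(ring i p, false), ⟨rfl, hq⟩, rfl⟩
    | core j' k =>
      obtain ⟨rfl, hk⟩ := hq
      exact ⟨(core j k, false), ⟨rfl, rfl, hk⟩, hcore k⟩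

/-- Some word carries the encoding of one configuration onto that of another one. -/
def Leads (m : ℕ) (c : Token) (L : List (Option (Fin 3))) (c' : Token)
    (L' : List (Option (Fin 3))) : Prop :=
  ∃ w : List (Fin 2), (w.foldl step ·) '' tokens (m := m) copy c L = tokens copy c' L'

theorem Leads.refl {m : ℕ} (c : Token) (L : List (Option (Fin 3))) : Leads m c L c L :=
  ⟨[], Set.image_id _⟩

theorem image_foldl_append {m : ℕ} (v w : List (Fin 2)) (T : Set (Cell m × Bool)) :
    ((v ++ w).foldl step ·) '' T = (w.foldl step ·) '' ((v.foldl step ·) '' T) := by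
  rw [Set.image_image]
  simp only [List.foldl_append]

theorem Leads.trans {m : ℕ} {c c' c'' : Token} {L L' L'' : List (Option (Fin 3))}
    (h : Leads m c L c' L') (h' : Leads m c' L' c'' L'') : Leads m c L c'' L'' := by
  obtain ⟨w, hw⟩ := h
  obtain ⟨w', hw'⟩ := h'
  exact ⟨w ++ w', by rw [image_foldl_append, hw, hw']⟩

theorem exists_phase_word {m : ℕ} (j : Phase) (c : Token) (L : List (Option (Fin 3))) :
    ∃ w : List (Fin 2), (w.foldl step ·) '' tokens (m := m) copy c L = tokens j c L := by
  have h : ∀ j' : Phase, j' ≠ reset →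
      (∃ w : List (Fin 2), (w.foldl step ·) '' tokens (m := m) copy c L = tokens j' c L) →
      ∃ w : List (Fin 2), (w.foldl step ·) '' tokens (m := m) copy c L = tokens j'.next c L := by
    rintro j' hj ⟨w, hw⟩
    exact ⟨w ++ [1], by rw [image_foldl_append, hw]; exact image_tokens_one hj c L⟩
  have h0 := h copy (by decide) ⟨[], Set.image_id _⟩
  have h1 := h carry (by decide) h0
  have h2 := h incr (by decide) h1
  have h3 := h erase (by decide) h2
  have h4 := h mark (by decide) h3
  cases j
  exacts [⟨[], Set.image_id _⟩, h0, h1, h2, h3, h4]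

theorem Leads.of_act {m : ℕ} (j : Phase) (hj : j ≠ reset) {c c' : Token}
    (hc : act j c = some (.inr c')) {h h' : Option (Fin 3)} (hh : Rewrites j h h')
    {L : List (Option (Fin 3))} (hL : L.length = m + 1) :
    Leads m c (h :: L) c' (L ++ [h']) := by
  obtain ⟨w, hw⟩ := exists_phase_word (m := m) j c (h :: L)
  exact ⟨w ++ [0], by rw [image_foldl_append, hw]; exact image_tokens_zero hj hc hh hL⟩

/-- Rotating a block of equal digits through the head while staying in the same mode. -/
theorem leads_replicate {m : ℕ} (j : Phase) (hj : j ≠ reset) {c : Token}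
    (hc : act j c = some (.inr c)) {h h' : Option (Fin 3)} (hh : Rewrites j h h') (k : ℕ)
    {L : List (Option (Fin 3))} (hL : k + L.length = m + 2) :
    Leads m c (List.replicate k h ++ L) c (L ++ List.replicate k h') := by
  induction k generalizing L with
  | zero => simpa using Leads.refl c L
  | succ k ih =>
    have h1 : Leads m c (h :: (List.replicate k h ++ L)) c (List.replicate k h ++ L ++ [h']) :=
      Leads.of_act j hj hc hh (by simp; omega)
    have h2 := ih (L := L ++ [h']) (by simp; omega)
    rw [List.append_assoc] at h1
    have h3 := h1.trans h2
    rwa [List.append_assoc, List.singleton_append, ← List.replicate_succ,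
      ← List.cons_append, ← List.replicate_succ] at h3

theorem leads_copy {m : ℕ} (X L : List (Option (Fin 3))) (hL : X.length + L.length = m + 2) :
    Leads m copying (X ++ L) copying (L ++ X) := by
  induction X generalizing L with
  | nil => simpa using Leads.refl copying L
  | cons h X ih =>
    have hh : Rewrites copy h h := by cases h <;> rfl
    have h1 : Leads m copying (h :: (X ++ L)) copying (X ++ L ++ [h]) :=
      Leads.of_act copy (by decide) rfl hh (by simp at hL ⊢; omega)
    rw [List.append_assoc] at h1
    simpa using h1.trans (ih (L ++ [h]) (by simp at hL ⊢; omega))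

/-- One pass of the head over the tape increments the counter. -/
theorem leads_increment {m : ℕ} (k : ℕ) {p p' : Fin 3}
    (hp : act incr (digit p) = some (.inl p')) (X : List (Option (Fin 3)))
    (hX : k + X.length = m) :
    Leads m carrying (List.replicate k (some 2) ++ some p :: (X ++ [none])) carrying
      (List.replicate k (some 0) ++ some p' :: (X ++ [none])) := by
  have h1 : Leads m carrying (List.replicate k (some 2) ++ some p :: (X ++ [none])) carrying _ :=
    leads_replicate carry (by decide) (h := some 2) (h' := some 0) rfl rfl k (by simp; omega)
  have h2 : Leads m carrying (some p :: (X ++ [none] ++ List.replicate k (some 0))) copying _ :=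
    Leads.of_act incr (by decide) (h := some p) (h' := some p') rfl hp (by simp; omega)
  have h3 := leads_copy (m := m) X (none :: (List.replicate k (some 0) ++ [some p']))
    (by simp; omega)
  have h4 : Leads m copying (none :: (List.replicate k (some 0) ++ [some p'] ++ X)) carrying _ :=
    Leads.of_act mark (by decide) (h := none) (h' := none) rfl rfl (by simp; omega)
  simp only [List.append_assoc, List.cons_append, List.nil_append] at h1 h2 h3 h4 ⊢
  exact ((h1.trans h2).trans h3).trans h4

theorem leads_count {m : ℕ} (k : ℕ) (X : List (Option (Fin 3))) (hX : k + X.length = m + 1) :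
    Leads m carrying (List.replicate k (some 0) ++ (X ++ [none])) carrying
      (List.replicate k (some 2) ++ (X ++ [none])) := by
  induction k generalizing X with
  | zero => exact Leads.refl _ _
  | succ k ih =>
    have h0 := ih (some 0 :: X) (by simp; omega)
    have h1 := ih (some 1 :: X) (by simp; omega)
    have h2 := ih (some 2 :: X) (by simp; omega)
    have i0 := leads_increment (m := m) k (p := 0) (p' := 1) rfl X (by omega)
    have i1 := leads_increment (m := m) k (p := 1) (p' := 2) rfl X (by omega)
    have h := (((h0.trans i0).trans h1).trans i1).trans h2
    simpa [List.replicate_succ'] using h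

theorem exists_sync {m : ℕ} : ∃ w : List (Fin 2), ∀ s ∈ tokens (m := m) copy carrying
    (List.replicate (m + 1) (some 0) ++ [none]), w.foldl step s = (core copy anchor, false) := by
  have h1 := leads_count (m := m) (m + 1) [] rfl
  have h2 : Leads m carrying (some 2 :: (List.replicate m (some 2) ++ [none])) erasing _ :=
    Leads.of_act erase (by decide) (h := some 2) (h' := none) rfl rfl (by simp)
  have h3 : Leads m erasing (List.replicate m (some 2) ++ [none, none]) erasing _ :=
    leads_replicate erase (by decide) (h := some 2) (h' := none) rfl rfl m (by simp)
  have h4 : Leads m erasing (none :: none :: List.replicate m none) anchor _ :=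
    Leads.of_act mark (by decide) (h := none) (h' := none) rfl rfl (by simp)
  simp only [List.append_assoc, List.cons_append, List.nil_append, List.replicate_succ]
    at h1 h2 h3 h4 ⊢
  obtain ⟨w, hw⟩ := ((h1.trans h2).trans h3).trans h4
  refine ⟨w, fun s hs => ?_⟩
  have hmem := hw.subset ⟨s, hs, rfl⟩
  have hnone : none :: (List.replicate m none ++ [none]) =
      List.replicate (m + 2) (none : Option (Fin 3)) := by
    rw [← List.replicate_succ', ← List.replicate_succ]
  rw [hnone] at hmem
  beta_reduce at hmem
  generalize w.foldl step s = q at hmem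
  obtain ⟨q, b⟩ := q
  obtain ⟨hb, hq⟩ := hmem
  obtain rfl : b = false := hb
  cases q with
  | ring i p => simp [List.getElem?_replicate] at hq
  | core j k =>
    obtain ⟨rfl, rfl | rfl | ⟨p, -, hp⟩⟩ := hq
    · rfl
    · rfl
    · simp at hp

/-- The value of a list of ternary digits, least significant digit first. -/
def value (X : List (Fin 3)) : ℕ := Nat.ofDigits 3 (X.map Fin.val)

theorem value_cons (p : Fin 3) (X : List (Fin 3)) : value (p :: X) = p + 3 * value X := by
  simp [value, Nat.ofDigits_cons]

theorem value_append (X Y : List (Fin 3)) :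
    value (X ++ Y) = value X + 3 ^ X.length * value Y := by
  simp [value, Nat.ofDigits_append]

theorem value_replicate_zero (r : ℕ) : value (List.replicate r 0) = 0 := by
  induction r with
  | zero => rfl
  | succ r ih => rw [List.replicate_succ, value_cons, ih]; rfl

theorem value_of_forall_eq_two {X : List (Fin 3)} (h : ∀ p ∈ X, p = 2) :
    value X + 1 = 3 ^ X.length := by
  induction X with
  | nil => rfl
  | cons p X ih =>
    obtain rfl : p = 2 := h p (by simp)
    have h1 := ih fun p hp => h p (by simp [hp])
    rw [value_cons, List.length_cons, pow_succ, ← h1]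
    simp only [Fin.val_two]
    ring

/-- The configurations that can arise after reading `t` letters: the tape splits at its empty cell
into the digits still to be processed in the current pass and the digits already processed. -/
inductive Good (m t : ℕ) : Token → List (Option (Fin 3)) → Prop
  | carrying (X : List (Fin 3)) (r : ℕ) (hlen : X.length + r = m + 1)
      (hval : (value X + 1) * 3 ^ r ≤ t + 1) :
      Good m t carrying (X.map some ++ none :: List.replicate r (some 0))
  | copying (X Y : List (Fin 3)) (hlen : X.length + Y.length = m + 1)
      (hval : value (Y ++ X) ≤ t) :
      Good m t copying (X.map some ++ none :: Y.map some)
  | erasing (X : List (Fin 3)) (Y : List (Option (Fin 3))) (hlen : X.length + Y.length = m + 1)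
      (hval : (∀ p ∈ X, p = 2) → 3 ^ (m + 1) ≤ t + 1) :
      Good m t erasing (X.map some ++ none :: Y)

theorem Good.mono {m t t' : ℕ} (ht : t ≤ t') {c : Token} {L : List (Option (Fin 3))}
    (h : Good m t c L) : Good m t' c L := by
  cases h with
  | carrying X r hlen hval => exact .carrying X r hlen (by omega)
  | copying X Y hlen hval => exact .copying X Y hlen (by omega)
  | erasing X Y hlen hval => exact .erasing X Y hlen fun hX => (hval hX).trans (by omega)

theorem Good.length {m t : ℕ} {c : Token} {L : List (Option (Fin 3))} (h : Good m t c L) :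
    L.length = m + 2 := by
  cases h <;> simp <;> omega

theorem Good.control {m t : ℕ} {c : Token} {L : List (Option (Fin 3))} (h : Good m t c L) :
    c = .carrying ∨ c = .copying ∨ c = .erasing := by
  cases h <;> simp

theorem act_digit_inr {j : Phase} {p : Fin 3} {k : Token} (h : act j (digit p) = some (.inr k)) :
    k = anchor := by
  cases j <;> fin_cases p <;> simp_all [act]

theorem rewrites_copy {p : Fin 3} {h' : Option (Fin 3)} (hh : Rewrites copy (some p) h') :
    h' = some p := by
  cases h' <;> simp_all [Rewrites, act]

theorem rewrites_carry {p : Fin 3} {h' : Option (Fin 3)} (hh : Rewrites carry (some p) h') :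
    p = 2 ∧ h' = some 0 := by
  fin_cases p <;> cases h' <;> simp_all [Rewrites, act]

theorem rewrites_incr {p : Fin 3} {h' : Option (Fin 3)} (hh : Rewrites incr (some p) h') :
    ∃ p' : Fin 3, h' = some p' ∧ p'.val = p.val + 1 := by
  fin_cases p <;> cases h' <;> simp [Rewrites, act] at hh <;> subst hh <;> simp

theorem rewrites_erase {p : Fin 3} {h' : Option (Fin 3)} (hh : Rewrites erase (some p) h') :
    p = 2 ∧ h' = none := by
  fin_cases p <;> cases h' <;> simp_all [Rewrites, act]

theorem not_rewrites_mark {p : Fin 3} {h' : Option (Fin 3)} : ¬ Rewrites mark (some p) h' := by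
  cases h' <;> simp [Rewrites, act]

theorem Good.rotate_carrying {m t : ℕ} {j : Phase} {c' : Token} {h h' : Option (Fin 3)}
    {L : List (Option (Fin 3))} (hc : act j .carrying = some (.inr c')) (hh : Rewrites j h h')
    (X : List (Fin 3)) (r : ℕ) (hlen : X.length + r = m + 1)
    (hval : (value X + 1) * 3 ^ r ≤ t + 1)
    (hL : h :: L = X.map some ++ none :: List.replicate r (some 0)) :
    3 ^ (m + 1) ≤ t + 1 ∨ Good m (t + 1) c' (L ++ [h']) := by
  cases X with
  | nil =>
    left
    simp only [List.length_nil, zero_add] at hlen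
    subst hlen
    simpa [value] using hval
  | cons p X =>
    right
    simp only [List.map_cons, List.cons_append, List.cons.injEq] at hL
    obtain ⟨rfl, rfl⟩ := hL
    simp only [List.length_cons] at hlen
    rw [value_cons] at hval
    cases j <;> simp only [act, reduceCtorEq, Option.some.injEq, Sum.inr.injEq] at hc <;> subst hc
    · obtain ⟨rfl, rfl⟩ : p = 2 ∧ h' = some 0 := rewrites_carry hh
      have := Good.carrying (m := m) (t := t + 1) X (r + 1) (by omega)
        (by rw [pow_succ]; simp at hval; linarith)
      simpa [List.replicate_succ'] using this
    · obtain ⟨p', rfl, hp⟩ : ∃ p' : Fin 3, h' = some p' ∧ p'.val = p.val + 1 :=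
        rewrites_incr hh
      have := Good.copying (m := m) (t := t + 1) X (List.replicate r 0 ++ [p']) (by simp; omega) (by
        simp only [value_append, value_replicate_zero, value_cons, List.length_append,
          List.length_replicate, List.length_singleton, hp, pow_succ]
        simp only [value, List.map_nil, Nat.ofDigits_nil]
        have : 0 < 3 ^ r := by positivity
        simp only [value] at hval
        nlinarith)
      simpa using this
    · obtain ⟨rfl, rfl⟩ : p = 2 ∧ h' = none := rewrites_erase hh
      have := Good.erasing (m := m) (t := t + 1) X (List.replicate r (some 0) ++ [none])
        (by simp; omega) (by
          intro hX
          have h1 := value_of_forall_eq_two hX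
          have h2 : 3 ^ (m + 1) = 3 ^ X.length * 3 * 3 ^ r := by
            rw [← pow_succ, ← pow_add, hlen]
          rw [h2, ← h1]
          simp at hval
          linarith)
      simpa using this

theorem Good.rotate_copying {m t : ℕ} {j : Phase} {c' : Token} {h h' : Option (Fin 3)}
    {L : List (Option (Fin 3))} (hc : act j .copying = some (.inr c')) (hh : Rewrites j h h')
    (X Y : List (Fin 3)) (hlen : X.length + Y.length = m + 1) (hval : value (Y ++ X) ≤ t)
    (hL : h :: L = X.map some ++ none :: Y.map some) : Good m (t + 1) c' (L ++ [h']) := by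
  cases X with
  | nil =>
    simp only [List.map_nil, List.nil_append, List.cons.injEq] at hL
    obtain ⟨rfl, rfl⟩ := hL
    obtain rfl : h' = none := hh
    simp only [List.append_nil] at hval
    simp only [List.length_nil, zero_add] at hlen
    cases j <;> simp only [act, reduceCtorEq, Option.some.injEq, Sum.inr.injEq] at hc <;> subst hc
    · exact Good.copying Y [] (by simpa using hlen) (by simpa using hval.trans (Nat.le_succ t))
    · exact Good.carrying Y 0 (by simpa using hlen) (by simp; omega)
  | cons p X =>
    simp only [List.map_cons, List.cons_append, List.cons.injEq] at hL
    obtain ⟨rfl, rfl⟩ := hL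
    simp only [List.length_cons] at hlen
    cases j <;> simp only [act, reduceCtorEq, Option.some.injEq, Sum.inr.injEq] at hc <;> subst hc
    · obtain rfl : h' = some p := rewrites_copy hh
      have := Good.copying (m := m) (t := t + 1) X (Y ++ [p]) (by simp; omega)
        (by simpa using hval.trans (Nat.le_succ t))
      simpa using this
    · exact absurd hh not_rewrites_mark

theorem Good.rotate_erasing {m t : ℕ} {j : Phase} {c' : Token} {h h' : Option (Fin 3)}
    {L : List (Option (Fin 3))} (hc : act j .erasing = some (.inr c')) (hh : Rewrites j h h')
    (X : List (Fin 3)) (Y : List (Option (Fin 3))) (hlen : X.length + Y.length = m + 1)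
    (hval : (∀ p ∈ X, p = 2) → 3 ^ (m + 1) ≤ t + 1)
    (hL : h :: L = X.map some ++ none :: Y) :
    3 ^ (m + 1) ≤ t + 1 ∨ Good m (t + 1) c' (L ++ [h']) := by
  cases X with
  | nil => exact Or.inl (hval (by simp))
  | cons p X =>
    right
    simp only [List.map_cons, List.cons_append, List.cons.injEq] at hL
    obtain ⟨rfl, rfl⟩ := hL
    simp only [List.length_cons] at hlen
    cases j <;> simp only [act, reduceCtorEq, Option.some.injEq, Sum.inr.injEq] at hc <;> subst hc
    · obtain ⟨rfl, rfl⟩ : p = 2 ∧ h' = none := rewrites_erase hh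
      have := Good.erasing (m := m) (t := t + 1) X (Y ++ [none]) (by simp; omega)
        fun hX => (hval (by simpa using hX)).trans (by omega)
      simpa using this
    · exact absurd hh not_rewrites_mark

theorem Good.rotate {m t : ℕ} {j : Phase} {c c' : Token} {h h' : Option (Fin 3)}
    {L : List (Option (Fin 3))} (hG : Good m t c (h :: L)) (hc : act j c = some (.inr c'))
    (hh : Rewrites j h h') : 3 ^ (m + 1) ≤ t + 1 ∨ Good m (t + 1) c' (L ++ [h']) := by
  generalize hT : h :: L = T at hG
  cases hG with
  | carrying X r hlen hval => exact Good.rotate_carrying hc hh X r hlen hval hT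
  | copying X Y hlen hval => exact Or.inr (Good.rotate_copying hc hh X Y hlen hval hT)
  | erasing X Y hlen hval => exact Good.rotate_erasing hc hh X Y hlen hval hT

theorem step_core_zero_of_none {m : ℕ} {j : Phase} (hj : j ≠ reset) {k : Token}
    (h : act j k = none) : step (m := m) (core j k, false) 0 = (core copy anchor, true) := by
  simp only [step, if_true, rotate_core hj, h]
  rfl

theorem anchor_mem {m : ℕ} (j : Phase) (c : Token) (L : List (Option (Fin 3))) :
    ((core j anchor, false) : Cell m × Bool) ∈ tokens j c L :=
  ⟨rfl, rfl, Or.inl rfl⟩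

theorem control_mem {m : ℕ} (j : Phase) (c : Token) (L : List (Option (Fin 3))) :
    ((core j c, false) : Cell m × Bool) ∈ tokens j c L :=
  ⟨rfl, rfl, Or.inr (Or.inl rfl)⟩

theorem Good.le_length {m : ℕ} (q : Cell m × Bool) (w : List (Fin 2)) (t : ℕ) (j : Phase)
    (c : Token) (L : List (Option (Fin 3))) (hG : Good m t c L)
    (hw : ∀ s ∈ tokens j c L, w.foldl step s = q) : 3 ^ (m + 1) ≤ t + w.length + 1 := by
  induction w generalizing t j c L with
  | nil =>
    have h1 := (hw _ (anchor_mem j c L)).trans (hw _ (control_mem j c L)).symm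
    simp only [List.foldl_nil, Prod.mk.injEq, core.injEq] at h1
    obtain ⟨⟨-, rfl⟩, -⟩ := h1
    simpa using hG.control
  | cons x w ih =>
    have hclash : ∀ s s' : Cell m × Bool, s ∈ tokens j c L → s' ∈ tokens j c L → ∀ r,
        step s x = (r, true) → step s' x = (r, false) → False := by
      intro s s' hs hs' r h1 h2
      apply foldl_step_ne w r
      rw [← h1, ← h2]
      exact (hw s hs).trans (hw s' hs').symm
    have hnext : ∀ j' c' L', (step · x) '' tokens (m := m) j c L = tokens j' c' L' →
        Good m (t + 1) c' L' → 3 ^ (m + 1) ≤ t + (x :: w).length + 1 := by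
      intro j' c' L' himage hG'
      have h1 := ih (t + 1) j' c' L' hG' (by
        rw [← himage]
        rintro _ ⟨s, hs, rfl⟩
        exact hw s hs)
      rw [List.length_cons]
      omega
    by_cases hj : j = reset
    · subst hj
      exfalso
      refine hclash _ _ (control_mem reset c L) (anchor_mem reset c L)
        (if x = 0 then core copy (digit 0) else core copy .carrying) ?_ ?_
      · rcases hG.control with rfl | rfl | rfl <;> fin_cases x <;> rfl
      · fin_cases x <;> rfl
    · have hx : x = 0 ∨ x = 1 := by omega
      rcases hx with rfl | rfl
      · have hanchor : step (m := m) (core j anchor, false) 0 = (core copy anchor, false) :=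
          step_core_zero hj (act_anchor j)
        have hlen := hG.length
        cases L with
        | nil => simp at hlen
        | cons h L =>
          have hcontrol : act j c = none ∨ ∃ c', act j c = some (.inr c') := by
            rcases hG.control with rfl | rfl | rfl <;> cases j <;> simp [act]
          have hhead : (∃ p, h = some p ∧ act j (digit p) = none) ∨ ∃ h', Rewrites j h h' := by
            cases h with
            | none => exact Or.inr ⟨none, rfl⟩
            | some p =>
              cases hact : act j (digit p) with
              | none => exact Or.inl ⟨p, rfl, hact⟩
              | some r =>
                cases r with
                | inl p' => exact Or.inr ⟨some p', hact⟩
                | inr k =>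
                  obtain rfl := act_digit_inr hact
                  exact Or.inr ⟨none, hact⟩
          rcases hcontrol with hc | ⟨c', hc⟩
          · exact (hclash _ _ (control_mem j c _) (anchor_mem j c _) _
              (step_core_zero_of_none hj hc) hanchor).elim
          · rcases hhead with ⟨p, rfl, hp⟩ | ⟨h', hh⟩
            · exact (hclash (core j (digit p), false) _
                ⟨rfl, rfl, Or.inr (Or.inr ⟨p, rfl, rfl⟩)⟩ (anchor_mem j c _) _
                (step_core_zero_of_none hj hp) hanchor).elim
            · rcases hG.rotate hc hh with hb | hG'
              · omega
              · exact hnext _ _ _ (image_tokens_zero hj hc hh (by simpa using hlen)) hG'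
      · exact hnext _ _ _ (image_tokens_one hj c L) (hG.mono (by omega))

theorem hasSlowSubset (m : ℕ) : HasSlowSubset (Cell m × Bool) (3 ^ (m + 1)) := by
  refine ⟨step, tokens copy .carrying (List.replicate (m + 1) (some 0) ++ [none]),
    reaches_all, ⟨(core copy anchor, true), (core copy .carrying, false), by simp, rfl⟩,
    ⟨_, anchor_mem _ _ _⟩, ?_, ?_⟩
  · obtain ⟨w, hw⟩ := exists_sync (m := m)
    exact ⟨w, _, hw⟩
  · intro w q hw
    have hG := Good.carrying (m := m) (t := 0) (List.replicate (m + 1) 0) 0 (by simp)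
      (by rw [value_replicate_zero]; rfl)
    simpa using hG.le_length q w 0 copy _ _ (by simpa using hw)

end TernaryCounter

theorem stmt13 (ε : ℝ) (hε0 : 0 < ε) (hε1 : ε < 1) :
    ∃ c : ℝ, 0 < c ∧ ∃ n₀ : ℕ, ∀ n : ℕ, n₀ ≤ n →
      ∃ (δ : Fin n → Fin 2 → Fin n) (S : Finset (Fin n)),
        dfaTransitive δ ∧
        (∃ w, dfaSync δ S w) ∧
        (∀ w, dfaSync δ S w →
          c * (3 - ε) ^ ((n : ℝ) / 6) ≤ (w.length : ℝ)) := by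
  refine ⟨(1 / 3) ^ 16, by positivity, 90, fun n hn => ?_⟩
  obtain ⟨m, k, hk, rfl⟩ : ∃ m k, k < 6 ∧ n = 6 * m + 90 + k :=
    ⟨(n - 90) / 6, (n - 90) % 6, by omega, by omega⟩
  have hslow : HasSlowSubset (Fin (6 * m + 90)) (3 ^ (m + 1)) :=
    (TernaryCounter.hasSlowSubset m).congr (Fintype.equivFinOfCardEq (TernaryCounter.card_signed m))
  obtain ⟨δ, S, htrans, hsync, hlow⟩ := (hslow.fin_add k).exists_dfa
  refine ⟨δ, S, htrans, hsync, fun w hw => ?_⟩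
  have hB : (3 : ℝ) ^ (m + 1) ≤ w.length + 1 := by exact_mod_cast hlow w hw
  have hexp : ((6 * m + 90 + k : ℕ) : ℝ) / 6 ≤ (m + 16 : ℕ) := by
    have : (k : ℝ) < 6 := by exact_mod_cast hk
    push_cast
    linarith
  have hpow : (3 - ε) ^ (((6 * m + 90 + k : ℕ) : ℝ) / 6) ≤ 3 ^ (m + 16) :=
    calc (3 - ε) ^ (((6 * m + 90 + k : ℕ) : ℝ) / 6)
        ≤ 3 ^ (((6 * m + 90 + k : ℕ) : ℝ) / 6) :=
          Real.rpow_le_rpow (by linarith) (by linarith) (by positivity)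
      _ ≤ 3 ^ ((m + 16 : ℕ) : ℝ) := Real.rpow_le_rpow_of_exponent_le (by norm_num) hexp
      _ = 3 ^ (m + 16) := Real.rpow_natCast _ _
  calc (1 / 3) ^ 16 * (3 - ε) ^ (((6 * m + 90 + k : ℕ) : ℝ) / 6)
      ≤ (1 / 3) ^ 16 * 3 ^ (m + 16) := by gcongr
    _ = 3 ^ m := by rw [pow_add]; ring
    _ ≤ w.length := by
      have h1 : (1 : ℝ) ≤ 3 ^ m := one_le_pow₀ (by norm_num)
      rw [pow_succ] at hB
      linarith
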